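/- Let u be a permutation of {1,…,n}, and set N(u) := {y ∈ N : u̇·y·u̇⁻¹ ∈ N₋} and N'(u) := {y ∈ N : u̇·y·u̇⁻¹ ∈ N}. Then: (1) every y ∈ N can be written uniquely as y = y₁·y₂ with y₁ ∈ N(u) and y₂ ∈ N'(u); (2) every y ∈ N can be written uniquely as y = y₂·y₁ with y₂ ∈ N'(u) and y₁ ∈ N(u); (3) every z ∈ SL(n,ℂ) with u̇·z·u̇⁻¹ ∈ N can be written uniquely as z = z₁·z₂, where z₁ ∈ N with u̇·z₁·u̇⁻¹ ∈ N, and z₂ ∈ N₋ with u̇·z₂·u̇⁻¹ ∈ N. -/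

import Mathlib

open Matrix Finset

namespace Paper

open scoped Classical

noncomputable section

variable {K : Type*} [Field K] {n m : ℕ}

/-- `N`: upper unitriangular matrices. -/
def IsN (g : Matrix (Fin n) (Fin n) K) : Prop :=
  (∀ i, g i i = 1) ∧ ∀ i j : Fin n, j < i → g i j = 0

/-- `N₋`: lower unitriangular matrices. -/
def IsNm (g : Matrix (Fin n) (Fin n) K) : Prop :=
  (∀ i, g i i = 1) ∧ ∀ i j : Fin n, i < j → g i j = 0

/-- `B`: upper triangular matrices of determinant 1. -/
def IsB (g : Matrix (Fin n) (Fin n) K) : Prop :=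
  g.det = 1 ∧ ∀ i j : Fin n, j < i → g i j = 0

/-- `B₋`: lower triangular matrices of determinant 1. -/
def IsBm (g : Matrix (Fin n) (Fin n) K) : Prop :=
  g.det = 1 ∧ ∀ i j : Fin n, i < j → g i j = 0

/-- `H`: diagonal matrices of determinant 1. -/
def IsH (g : Matrix (Fin n) (Fin n) K) : Prop :=
  g.det = 1 ∧ ∀ i j : Fin n, i ≠ j → g i j = 0

/-- UDL factorization: `g = yp * y0 * ym` with `yp ∈ N`, `y0 ∈ H`, `ym ∈ N₋`. -/
def UDL (g yp y0 ym : Matrix (Fin n) (Fin n) K) : Prop :=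
  IsN yp ∧ IsH y0 ∧ IsNm ym ∧ g = yp * y0 * ym

/-- LDU factorization: `g = zm * z0 * zp` with `zm ∈ N₋`, `z0 ∈ H`, `zp ∈ N`. -/
def LDU (g zm z0 zp : Matrix (Fin n) (Fin n) K) : Prop :=
  IsNm zm ∧ IsH z0 ∧ IsN zp ∧ g = zm * z0 * zp

/-- The signed permutation matrix `v̇`. -/
def pdot (v : Equiv.Perm (Fin n)) : Matrix (Fin n) (Fin n) K :=
  Matrix.of fun a b : Fin n =>
    if a = v b then
      (-1 : K) ^ (univ.filter fun k : Fin n => b < k ∧ v k < v b).card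
    else 0

/-- Membership in the double coset `B₋ w B₋`. -/
def InBmWBm (w : Equiv.Perm (Fin n)) (g : Matrix (Fin n) (Fin n) K) : Prop :=
  ∃ b₁ b₂ : Matrix (Fin n) (Fin n) K, IsBm b₁ ∧ IsBm b₂ ∧ g = b₁ * pdot w * b₂

/-- `Δ^I_J(g)`: the minor with row set `I` and column set `J` (junk value 0 if sizes differ). -/
def minor (g : Matrix (Fin n) (Fin n) K) (I J : Finset (Fin n)) : K :=
  if h : I.card = J.card then
    Matrix.det (Matrix.of fun a b : Fin I.card =>
      g (I.orderEmbOfFin rfl a) (J.orderEmbOfFin h.symm b))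
  else 0

/-- All right-aligned flag minors of `g` are nonnegative. -/
def RightFlagNonneg (g : Matrix (Fin n) (Fin n) ℝ) : Prop :=
  ∀ I : Finset (Fin n),
    0 ≤ minor g I (univ.filter fun j : Fin n => n - I.card ≤ (j : ℕ))

/-- All top-aligned flag minors of `g` are nonnegative. -/
def TopFlagNonneg (g : Matrix (Fin n) (Fin n) ℝ) : Prop :=
  ∀ J : Finset (Fin n),
    0 ≤ minor g (univ.filter fun i : Fin n => (i : ℕ) < J.card) J

/-- `x_i(t)` (with 1-based `i`): `Id + t·E_{i,i+1}`. -/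
def xmat (i : ℕ) (t : K) : Matrix (Fin n) (Fin n) K :=
  Matrix.of fun a b : Fin n =>
    if a = b then 1 else if (a : ℕ) + 1 = i ∧ (b : ℕ) = i then t else 0

/-- `y_i(t)` (with 1-based `i`): `Id + t·E_{i+1,i}`. -/
def ymat (i : ℕ) (t : K) : Matrix (Fin n) (Fin n) K :=
  Matrix.of fun a b : Fin n =>
    if a = b then 1 else if (a : ℕ) = i ∧ (b : ℕ) + 1 = i then t else 0

/-- `ṡ_i` (with 1-based `i`). -/
def sdot (i : ℕ) : Matrix (Fin n) (Fin n) K :=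
  Matrix.of fun a b : Fin n =>
    if (a : ℕ) + 1 = i ∧ (b : ℕ) = i then 1
    else if (a : ℕ) = i ∧ (b : ℕ) + 1 = i then -1
    else if a = b ∧ (a : ℕ) + 1 ≠ i ∧ (a : ℕ) ≠ i then 1
    else 0

/-- The adjacent transposition `s_i` (with 1-based `i`); identity if out of range. -/
def sperm (n : ℕ) (i : ℕ) : Equiv.Perm (Fin n) :=
  if h : i < n then
    Equiv.swap ⟨i - 1, Nat.lt_of_le_of_lt (Nat.sub_le i 1) h⟩ ⟨i, h⟩
  else 1

/-- `ℓ(w)`: the number of inversions of `w`. -/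
def len (w : Equiv.Perm (Fin n)) : ℕ :=
  (univ.filter fun p : Fin n × Fin n => p.1 < p.2 ∧ w p.2 < w p.1).card

/-- `vseq ii v k = v_{(m-k)}`: the rightmost (positive distinguished) subexpression recursion. -/
def vseq (ii : Fin m → ℕ) (v : Equiv.Perm (Fin n)) : ℕ → Equiv.Perm (Fin n)
  | 0 => v
  | k + 1 =>
    if h : m - k - 1 < m then
      if len (vseq ii v k * sperm n (ii ⟨m - k - 1, h⟩)) < len (vseq ii v k) then
        vseq ii v k * sperm n (ii ⟨m - k - 1, h⟩)
      else vseq ii v k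
    else vseq ii v k

/-- `r ∈ J°` (0-based `r`, corresponding to the 1-based index `r+1`). -/
def inJ (ii : Fin m → ℕ) (v : Equiv.Perm (Fin n)) (r : Fin m) : Prop :=
  vseq ii v (m - (r : ℕ)) = vseq ii v (m - (r : ℕ) - 1)

/-- The list `[s_{i_1}, …, s_{i_m}]` of adjacent transpositions. -/
def sPermList (n : ℕ) (ii : Fin m → ℕ) : List (Equiv.Perm (Fin n)) :=
  List.ofFn fun r => sperm n (ii r)

/-- The list `[s^v_{i_1}, …, s^v_{i_m}]`. -/
def svPermList (ii : Fin m → ℕ) (v : Equiv.Perm (Fin n)) : List (Equiv.Perm (Fin n)) :=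
  List.ofFn fun r => if inJ ii v r then 1 else sperm n (ii r)

/-- The factors `g_1, …, g_m` of the Marsh–Rietsch element. -/
def mrgList (ii : Fin m → ℕ) (v : Equiv.Perm (Fin n)) (t : Fin m → K) :
    List (Matrix (Fin n) (Fin n) K) :=
  List.ofFn fun r => if inJ ii v r then xmat (ii r) (t r) else sdot (ii r)

/-- The Marsh–Rietsch element `g = g_1 ⋯ g_m`. -/
def mrg (ii : Fin m → ℕ) (v : Equiv.Perm (Fin n)) (t : Fin m → K) :
    Matrix (Fin n) (Fin n) K :=
  (mrgList ii v t).prod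

/-- The list `[ṡ_{i_1}, …, ṡ_{i_m}]`. -/
def sdotList (n : ℕ) (ii : Fin m → ℕ) : List (Matrix (Fin n) (Fin n) K) :=
  List.ofFn fun r => sdot (ii r)

/-- `ẇ = ṡ_{i_1} ⋯ ṡ_{i_m}`. -/
def wMR (n : ℕ) (ii : Fin m → ℕ) : Matrix (Fin n) (Fin n) K :=
  (sdotList n ii).prod

/-- Unitriangular with respect to the order induced by `f`. -/
def UT {n : ℕ} (f : Fin n → ℤ) (a : Matrix (Fin n) (Fin n) ℂ) : Prop :=
  (∀ i, a i i = 1) ∧ ∀ i j, f j < f i → a i j = 0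

theorem UT.mul_diag {n : ℕ} {f : Fin n → ℤ} (hf : Function.Injective f)
    {a b : Matrix (Fin n) (Fin n) ℂ} (ha : UT f a) (hb : UT f b) (i : Fin n) :
    (a * b) i i = 1 := by
  rw [Matrix.mul_apply, Finset.sum_eq_single i]
  · rw [ha.1, hb.1, one_mul]
  · intro k _ hk
    have : f k ≠ f i := fun h => hk (hf h)
    rcases lt_or_gt_of_ne this with h | h
    · rw [ha.2 _ _ h, zero_mul]
    · rw [hb.2 _ _ h, mul_zero]
  · simp

theorem UT.mul_low {n : ℕ} {f : Fin n → ℤ}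
    {a b : Matrix (Fin n) (Fin n) ℂ} (ha : UT f a) (hb : UT f b) (i j : Fin n) (h : f j < f i) :
    (a * b) i j = 0 := by
  rw [Matrix.mul_apply]
  apply Finset.sum_eq_zero
  intro k _
  by_cases h1 : f k < f i
  · rw [ha.2 _ _ h1, zero_mul]
  · rw [hb.2 _ _ (by omega), mul_zero]

theorem UT.mul_up {n : ℕ} {f : Fin n → ℤ} (hf : Function.Injective f)
    {a b : Matrix (Fin n) (Fin n) ℂ} (ha : UT f a) (hb : UT f b) (i j : Fin n) (h : f i < f j) :
    (a * b) i j = a i j + b i j +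
      ∑ k ∈ univ.filter (fun k => f i < f k ∧ f k < f j), a i k * b k j := by
  have hij : i ≠ j := by rintro rfl; omega
  have e : ∀ k, a i k * b k j = (if k = i then b i j else 0) + (if k = j then a i j else 0) +
      (if f i < f k ∧ f k < f j then a i k * b k j else 0) := by
    intro k
    by_cases hi : k = i
    · subst hi; simp [hij, ha.1]
    by_cases hj : k = j
    · subst hj; simp [hi, hb.1]
    have h1 : f k ≠ f i := fun h => hi (hf h)
    have h2 : f k ≠ f j := fun h => hj (hf h)
    by_cases h3 : f k < f i
    · simp [hi, hj, ha.2 _ _ h3]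
    by_cases h4 : f j < f k
    · simp [hi, hj, hb.2 _ _ h4]
    have h5 : f i < f k ∧ f k < f j := by omega
    simp [hi, hj, h5]
  rw [Matrix.mul_apply, Finset.sum_congr rfl (fun k _ => e k), Finset.sum_add_distrib,
    Finset.sum_add_distrib, Finset.sum_filter]
  simp
  ring

/-- The recursion step. -/
def stepF {n : ℕ} (f g : Fin n → ℤ) (y c : Matrix (Fin n) (Fin n) ℂ) :
    Matrix (Fin n) (Fin n) ℂ := fun i j =>
  y i j - ∑ k ∈ univ.filter (fun k => f i < f k ∧ f k < f j),
    (if g i < g k then c i k else 0) * (if g k < g j then 0 else c k j)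

theorem stepF_congr {n : ℕ} (f g : Fin n → ℤ) (y c c' : Matrix (Fin n) (Fin n) ℂ) (d : ℕ)
    (h : ∀ i j, f j - f i < d → c i j = c' i j) (i j : Fin n) (hij : f j - f i < d + 1) :
    stepF f g y c i j = stepF f g y c' i j := by
  unfold stepF
  congr 1
  apply Finset.sum_congr rfl
  intro k hk
  simp only [Finset.mem_filter, Finset.mem_univ, true_and] at hk
  rw [h i k (by omega), h k j (by omega)]

theorem stepF_fix {n : ℕ} (f g : Fin n → ℤ) (y : Matrix (Fin n) (Fin n) ℂ) :
    ∃ c, ∀ i j, f i < f j → c i j = stepF f g y c i j := by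
  have key : ∀ d : ℕ, ∃ c, ∀ i j, f j - f i < d → c i j = stepF f g y c i j := by
    intro d
    induction d with
    | zero =>
      refine ⟨fun i j => y i j, fun i j h => ?_⟩
      unfold stepF
      rw [Finset.filter_eq_empty_iff.2]
      · simp
      · intro k _; push_cast at h; omega
    | succ d ih =>
      obtain ⟨c, hc⟩ := ih
      refine ⟨stepF f g y c, fun i j h => ?_⟩
      exact stepF_congr f g y _ _ d hc i j (by push_cast at h; omega)
  obtain ⟨c, hc⟩ := key (∑ i, ∑ j, ((f j - f i).toNat + 1))
  refine ⟨c, fun i j _ => hc i j ?_⟩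
  have h1 : (f j - f i).toNat + 1 ≤ ∑ j, ((f j - f i).toNat + 1) :=
    Finset.single_le_sum (f := fun j => (f j - f i).toNat + 1) (fun _ _ => Nat.zero_le _)
      (Finset.mem_univ j)
  have h2 : ∑ j, ((f j - f i).toNat + 1) ≤ ∑ i, ∑ j, ((f j - f i).toNat + 1) :=
    Finset.single_le_sum (f := fun i => ∑ j, ((f j - f i).toNat + 1)) (fun _ _ => Nat.zero_le _)
      (Finset.mem_univ i)
  omega

theorem UT_factor {n : ℕ} (f g : Fin n → ℤ) (hf : Function.Injective f)
    (hg : Function.Injective g) (y : Matrix (Fin n) (Fin n) ℂ) (hy : UT f y) :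
    ∃! p : Matrix (Fin n) (Fin n) ℂ × Matrix (Fin n) (Fin n) ℂ,
      (UT f p.1 ∧ UT g p.1) ∧ (UT f p.2 ∧ UT (fun i => - g i) p.2) ∧ y = p.1 * p.2 := by
  apply existsUnique_of_exists_of_unique
  · obtain ⟨c, hc⟩ := stepF_fix f g y
    let a : Matrix (Fin n) (Fin n) ℂ := fun i j =>
      if i = j then 1 else if f i < f j ∧ g i < g j then c i j else 0
    let b : Matrix (Fin n) (Fin n) ℂ := fun i j =>
      if i = j then 1 else if f i < f j ∧ ¬ g i < g j then c i j else 0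
    have ne : ∀ (h : Fin n → ℤ) (i j : Fin n), h j < h i → i ≠ j := by
      rintro h i j hl rfl; omega
    have ha : UT f a := by
      refine ⟨fun i => by simp [a], fun i j h => ?_⟩
      have h' : ¬ f i < f j := by omega
      simp [a, ne f i j h, h']
    have hb : UT f b := by
      refine ⟨fun i => by simp [b], fun i j h => ?_⟩
      have h' : ¬ f i < f j := by omega
      simp [b, ne f i j h, h']
    refine ⟨(a, b), ⟨ha, fun i => by simp [a], fun i j h => ?_⟩,
      ⟨hb, fun i => by simp [b], fun i j h => ?_⟩, ?_⟩
    · have h' : ¬ g i < g j := by omega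
      simp [a, ne g i j h, h']
    · have h' : g i < g j := by simpa using h
      simp [b, (ne g j i h').symm, h']
    · ext i j
      rcases lt_trichotomy (f i) (f j) with h | h | h
      · rw [UT.mul_up hf ha hb i j h]
        have hij : i ≠ j := (ne f j i h).symm
        have hs : a i j + b i j = c i j := by
          by_cases hh : g i < g j <;> simp [a, b, hij, h, hh]
        rw [hs, hc i j h]
        unfold stepF
        have : ∑ k ∈ univ.filter (fun k => f i < f k ∧ f k < f j), a i k * b k j =
          ∑ k ∈ univ.filter (fun k => f i < f k ∧ f k < f j),
            (if g i < g k then c i k else 0) * (if g k < g j then 0 else c k j) := by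
          apply Finset.sum_congr rfl
          intro k hk
          simp only [Finset.mem_filter, Finset.mem_univ, true_and] at hk
          have h1 := (ne f k i hk.1).symm
          have h2 := (ne f j k hk.2).symm
          simp only [a, b, if_neg h1, if_neg h2, hk.1, hk.2, true_and, ite_not]
        rw [this]; ring
      · have := hf h
        subst this
        rw [UT.mul_diag hf ha hb, hy.1]
      · rw [UT.mul_low ha hb i j h, hy.2 i j h]
  · rintro ⟨a, b⟩ ⟨a', b'⟩ ⟨⟨ha, ha2⟩, ⟨hb, hb2⟩, h⟩ ⟨⟨ha', ha2'⟩, ⟨hb', hb2'⟩, h'⟩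
    dsimp only at *
    have key : ∀ d : ℕ, ∀ i j, f j - f i < d → a i j = a' i j ∧ b i j = b' i j := by
      intro d
      induction d with
      | zero =>
        intro i j hij
        have : f j < f i := by push_cast at hij; omega
        rw [ha.2 _ _ this, hb.2 _ _ this, ha'.2 _ _ this, hb'.2 _ _ this]
        exact ⟨rfl, rfl⟩
      | succ d ih =>
        intro i j hij
        push_cast at hij
        rcases lt_trichotomy (f i) (f j) with hl | hl | hl
        · have e1 := UT.mul_up hf ha hb i j hl
          have e2 := UT.mul_up hf ha' hb' i j hl
          rw [← h] at e1
          rw [← h', e1] at e2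
          have : ∑ k ∈ univ.filter (fun k => f i < f k ∧ f k < f j), a i k * b k j =
            ∑ k ∈ univ.filter (fun k => f i < f k ∧ f k < f j), a' i k * b' k j := by
            apply Finset.sum_congr rfl
            intro k hk
            simp only [Finset.mem_filter, Finset.mem_univ, true_and] at hk
            rw [(ih i k (by omega)).1, (ih k j (by omega)).2]
          rw [this] at e2
          have e3 := add_right_cancel e2
          have hne : g i ≠ g j := fun hh => by have := hg hh; subst this; omega
          rcases lt_or_gt_of_ne hne with hh | hh
          · have hh' : -g j < -g i := by omega
            rw [hb2.2 i j hh', hb2'.2 i j hh'] at e3 ⊢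
            simpa using e3
          · rw [ha2.2 i j hh, ha2'.2 i j hh] at e3 ⊢
            simpa using e3
        · have := hf hl
          subst this
          rw [ha.1, hb.1, ha'.1, hb'.1]
          exact ⟨rfl, rfl⟩
        · rw [ha.2 _ _ hl, hb.2 _ _ hl, ha'.2 _ _ hl, hb'.2 _ _ hl]
          exact ⟨rfl, rfl⟩
    have key2 : ∀ i j, a i j = a' i j ∧ b i j = b' i j := fun i j =>
      key ((f j - f i).toNat + 1) i j (by push_cast; omega)
    ext i j
    · exact (key2 i j).1
    · exact (key2 i j).2

/-- The sign in column `b` of `pdot u`. -/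
def psgn {n : ℕ} (u : Equiv.Perm (Fin n)) (b : Fin n) : ℂ :=
  (-1 : ℂ) ^ (univ.filter fun k : Fin n => b < k ∧ u k < u b).card

theorem psgn_sq {n : ℕ} (u : Equiv.Perm (Fin n)) (b : Fin n) : psgn u b * psgn u b = 1 := by
  unfold psgn
  rw [← mul_pow]; simp

theorem pdot_apply {n : ℕ} (u : Equiv.Perm (Fin n)) (a b : Fin n) :
    (pdot u : Matrix (Fin n) (Fin n) ℂ) a b = if a = u b then psgn u b else 0 := rfl

theorem pdot_inv {n : ℕ} (u : Equiv.Perm (Fin n)) :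
    (pdot u : Matrix (Fin n) (Fin n) ℂ)⁻¹ = (pdot u)ᵀ := by
  apply Matrix.inv_eq_left_inv
  ext i j
  rw [Matrix.mul_apply]
  simp only [Matrix.transpose_apply, pdot_apply, ite_mul, zero_mul, Finset.sum_ite_eq',
    Finset.sum_ite_eq, Finset.mem_univ, if_true, Matrix.one_apply, EmbeddingLike.apply_eq_iff_eq]
  split_ifs with h
  · subst h; exact psgn_sq u i
  · simp

theorem conj_apply {n : ℕ} (u : Equiv.Perm (Fin n)) (p : Matrix (Fin n) (Fin n) ℂ) (i j : Fin n) :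
    (pdot u * p * (pdot u : Matrix (Fin n) (Fin n) ℂ)⁻¹ : Matrix (Fin n) (Fin n) ℂ) (u i) (u j) =
      psgn u i * p i j * psgn u j := by
  rw [pdot_inv]
  simp [Matrix.mul_apply, pdot_apply, Matrix.transpose_apply]

theorem psgn_ne {n : ℕ} (u : Equiv.Perm (Fin n)) (b : Fin n) : psgn u b ≠ 0 := by
  intro h; have := psgn_sq u b; simp [h] at this

theorem IsN_iff {n : ℕ} (p : Matrix (Fin n) (Fin n) ℂ) :
    IsN p ↔ UT (fun i => ((i : ℕ) : ℤ)) p := by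
  simp [IsN, UT]

theorem IsNm_iff {n : ℕ} (p : Matrix (Fin n) (Fin n) ℂ) :
    IsNm p ↔ UT (fun i => -((i : ℕ) : ℤ)) p := by
  simp [IsNm, UT]

theorem UT_conj_iff {n : ℕ} (u : Equiv.Perm (Fin n)) (f : Fin n → ℤ)
    (p : Matrix (Fin n) (Fin n) ℂ) :
    UT f (pdot u * p * (pdot u : Matrix (Fin n) (Fin n) ℂ)⁻¹) ↔ UT (fun i => f (u i)) p := by
  unfold UT
  have e1 : ∀ i, psgn u i * p i i * psgn u i = p i i := fun i => by
    rw [mul_right_comm, psgn_sq, one_mul]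
  constructor
  · rintro ⟨h1, h2⟩
    refine ⟨fun i => ?_, fun i j h => ?_⟩
    · rw [← e1, ← conj_apply, h1]
    · have := h2 (u i) (u j) h
      rw [conj_apply] at this
      simpa [psgn_ne] using this
  · rintro ⟨h1, h2⟩
    refine ⟨fun i => ?_, fun i j h => ?_⟩
    · obtain ⟨i, rfl⟩ := u.surjective i
      rw [conj_apply, e1, h1]
    · obtain ⟨i, rfl⟩ := u.surjective i
      obtain ⟨j, rfl⟩ := u.surjective j
      rw [conj_apply, h2 i j h]; simp

/-- unique factorizations `N = N(u)·N'(u) = N'(u)·N(u)` and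
`u̇⁻¹Nu̇ = (u̇⁻¹Nu̇ ∩ N)·(u̇⁻¹Nu̇ ∩ N₋)`. -/
theorem statement_4 {n : ℕ} (hn : 1 ≤ n) (u : Equiv.Perm (Fin n)) :
    (∀ y : Matrix (Fin n) (Fin n) ℂ, IsN y →
      ∃! p : Matrix (Fin n) (Fin n) ℂ × Matrix (Fin n) (Fin n) ℂ,
        (IsN p.1 ∧ IsNm (pdot u * p.1 * (pdot u : Matrix (Fin n) (Fin n) ℂ)⁻¹)) ∧
        (IsN p.2 ∧ IsN (pdot u * p.2 * (pdot u : Matrix (Fin n) (Fin n) ℂ)⁻¹)) ∧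
        y = p.1 * p.2) ∧
    (∀ y : Matrix (Fin n) (Fin n) ℂ, IsN y →
      ∃! p : Matrix (Fin n) (Fin n) ℂ × Matrix (Fin n) (Fin n) ℂ,
        (IsN p.1 ∧ IsN (pdot u * p.1 * (pdot u : Matrix (Fin n) (Fin n) ℂ)⁻¹)) ∧
        (IsN p.2 ∧ IsNm (pdot u * p.2 * (pdot u : Matrix (Fin n) (Fin n) ℂ)⁻¹)) ∧
        y = p.1 * p.2) ∧
    ∀ z : Matrix (Fin n) (Fin n) ℂ, z.det = 1 →
      IsN (pdot u * z * (pdot u : Matrix (Fin n) (Fin n) ℂ)⁻¹) →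
      ∃! p : Matrix (Fin n) (Fin n) ℂ × Matrix (Fin n) (Fin n) ℂ,
        (IsN p.1 ∧ IsN (pdot u * p.1 * (pdot u : Matrix (Fin n) (Fin n) ℂ)⁻¹)) ∧
        (IsNm p.2 ∧ IsN (pdot u * p.2 * (pdot u : Matrix (Fin n) (Fin n) ℂ)⁻¹)) ∧
        z = p.1 * p.2 := by
  have inj : Function.Injective (fun i : Fin n => ((i : ℕ) : ℤ)) := fun i j h =>
    Fin.ext (by simpa using h)
  have injm : Function.Injective (fun i : Fin n => -((i : ℕ) : ℤ)) := fun i j h =>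
    Fin.ext (by simpa using h)
  have inju : Function.Injective (fun i : Fin n => ((u i : ℕ) : ℤ)) := fun i j h =>
    u.injective (inj h)
  have injum : Function.Injective (fun i : Fin n => -((u i : ℕ) : ℤ)) := fun i j h =>
    u.injective (injm h)
  simp only [IsN_iff, IsNm_iff, UT_conj_iff]
  refine ⟨fun y hy => ?_, fun y hy => ?_, fun z _ hz => ?_⟩
  · simpa only [neg_neg] using UT_factor _ _ inj injum y hy
  · exact UT_factor _ _ inj inju y hy
  · have := UT_factor _ _ inju inj z hz
    simpa only [and_comm] using this

end
end Paper
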